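/- The function of two variables (α, β) ↦ Λ(α) + Λ(β) + Λ(π − α − β) is strictly concave on the open triangle {(α, β) ∈ ℝ² : α > 0, β > 0, α + β < π}. -/

import Mathlib

/-- The Lobachevsky function `Λ(x) = -∫₀ˣ log |2 sin t| dt`. -/
noncomputable def lobachevsky (x : ℝ) : ℝ :=
  -∫ t in (0:ℝ)..x, Real.log |2 * Real.sin t|

theorem lob_integrable (a b : ℝ) :
    IntervalIntegrable (fun t => Real.log |2 * Real.sin t|) MeasureTheory.volume a b := by
  have h : MeromorphicOn (fun t : ℝ => 2 * Real.sin t) (Set.uIcc a b) := by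
    intro x _
    have : AnalyticAt ℝ (fun t : ℝ => 2 * Real.sin t) x := by fun_prop
    exact this.meromorphicAt
  simpa [Real.norm_eq_abs] using h.intervalIntegrable_log_norm

theorem lob_hasDerivAt {x : ℝ} (h0 : 0 < x) (h1 : x < Real.pi) :
    HasDerivAt lobachevsky (-Real.log (2 * Real.sin x)) x := by
  have hs := Real.sin_pos_of_pos_of_lt_pi h0 h1
  have hm : Measurable (fun t => Real.log |2 * Real.sin t|) := by fun_prop
  have hc : ContinuousAt (fun t => Real.log |2 * Real.sin t|) x := by
    apply ContinuousAt.log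
    · fun_prop
    · positivity
  have := (intervalIntegral.integral_hasDerivAt_right (lob_integrable 0 x)
    hm.stronglyMeasurable.stronglyMeasurableAtFilter hc).neg
  rw [Real.log_abs] at this
  exact this

theorem log_sin_hasDerivAt {x : ℝ} (h0 : 0 < x) (h1 : x < Real.pi) :
    HasDerivAt (fun t => -Real.log (2 * Real.sin t)) (-(Real.cos x / Real.sin x)) x := by
  have hs := Real.sin_pos_of_pos_of_lt_pi h0 h1
  have := (((Real.hasDerivAt_sin x).const_mul 2).log (by positivity)).neg
  have e : Real.cos x / Real.sin x = 2 * Real.cos x / (2 * Real.sin x) := by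
    field_simp
  rw [e]
  exact this

theorem cot_form_pos {a b u v : ℝ} (ha : 0 < a) (hb : 0 < b) (hab : a + b < Real.pi)
    (huv : u ≠ 0 ∨ v ≠ 0) :
    0 < Real.cos a / Real.sin a * u ^ 2 + Real.cos b / Real.sin b * v ^ 2
      + Real.cos (Real.pi - a - b) / Real.sin (Real.pi - a - b) * (u + v) ^ 2 := by
  have h1 : 0 < Real.sin a := Real.sin_pos_of_pos_of_lt_pi ha (by linarith)
  have h2 : 0 < Real.sin b := Real.sin_pos_of_pos_of_lt_pi hb (by linarith)
  have h3 : 0 < Real.sin (a + b) := Real.sin_pos_of_pos_of_lt_pi (by linarith) hab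
  have e1 : Real.sin (Real.pi - a - b) = Real.sin (a + b) := by
    rw [← Real.sin_pi_sub (a + b)]; ring_nf
  have e2 : Real.cos (Real.pi - a - b) = - Real.cos (a + b) := by
    rw [← Real.cos_pi_sub (a + b)]; ring_nf
  rw [e1, e2]
  have hA : Real.cos a / Real.sin a + -Real.cos (a + b) / Real.sin (a + b)
      = Real.sin b / (Real.sin a * Real.sin (a + b)) := by
    field_simp
    have := Real.sin_sub (a + b) a
    rw [add_sub_cancel_left] at this
    linarith
  have hB : Real.cos a / Real.sin a * (Real.cos b / Real.sin b)
      + (Real.cos a / Real.sin a + Real.cos b / Real.sin b)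
        * (-Real.cos (a + b) / Real.sin (a + b)) = 1 := by
    field_simp
    rw [Real.sin_add, Real.cos_add]
    have p1 := Real.sin_sq_add_cos_sq a
    have p2 := Real.sin_sq_add_cos_sq b
    ring
  have hA' : 0 < Real.cos a / Real.sin a + -Real.cos (a + b) / Real.sin (a + b) := by
    rw [hA]; positivity
  generalize Real.cos a / Real.sin a = A at *
  generalize Real.cos b / Real.sin b = B at *
  generalize -Real.cos (a + b) / Real.sin (a + b) = C at *
  have key : (A + C) * (A * u ^ 2 + B * v ^ 2 + C * (u + v) ^ 2)
      = ((A + C) * u + C * v) ^ 2 + v ^ 2 := by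
    linear_combination v ^ 2 * hB
  have : 0 < (A + C) * (A * u ^ 2 + B * v ^ 2 + C * (u + v) ^ 2) := by
    rw [key]
    by_cases hv : v = 0
    · have hu : u ≠ 0 := by tauto
      subst hv
      have := mul_ne_zero hA'.ne' hu
      simp only [mul_zero, add_zero]
      positivity
    · positivity
  exact pos_of_mul_pos_right this hA'.le

theorem line_strictConcave {a b u v : ℝ} (huv : u ≠ 0 ∨ v ≠ 0)
    (h : ∀ t ∈ Set.Icc (0:ℝ) 1, 0 < a + t * u ∧ 0 < b + t * v ∧
      (a + t * u) + (b + t * v) < Real.pi) :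
    StrictConcaveOn ℝ (Set.Icc (0:ℝ) 1) (fun t => lobachevsky (a + t * u)
      + lobachevsky (b + t * v) + lobachevsky (Real.pi - (a + t * u) - (b + t * v))) := by
  have l1 : ∀ t : ℝ, HasDerivAt (fun t => a + t * u) u t := fun t => by
    simpa using ((hasDerivAt_id t).mul_const u).const_add a
  have l2 : ∀ t : ℝ, HasDerivAt (fun t => b + t * v) v t := fun t => by
    simpa using ((hasDerivAt_id t).mul_const v).const_add b
  have l3 : ∀ t : ℝ, HasDerivAt (fun t => Real.pi - (a + t * u) - (b + t * v)) (-u - v) t :=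
    fun t => ((l1 t).const_sub Real.pi).sub (l2 t)
  have d1 : ∀ t ∈ Set.Icc (0:ℝ) 1, HasDerivAt (fun t => lobachevsky (a + t * u)
      + lobachevsky (b + t * v) + lobachevsky (Real.pi - (a + t * u) - (b + t * v)))
      (-Real.log (2 * Real.sin (a + t * u)) * u + -Real.log (2 * Real.sin (b + t * v)) * v
       + -Real.log (2 * Real.sin (Real.pi - (a + t * u) - (b + t * v))) * (-u - v)) t := by
    intro t ht
    obtain ⟨p, q, r⟩ := h t ht
    exact (((lob_hasDerivAt p (by linarith)).comp t (l1 t)).add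
      ((lob_hasDerivAt q (by linarith)).comp t (l2 t))).add
      (HasDerivAt.comp t (lob_hasDerivAt (by linarith) (by linarith)) (l3 t))
  apply strictConcaveOn_of_deriv2_neg (convex_Icc _ _)
  · exact fun t ht => (d1 t ht).continuousAt.continuousWithinAt
  · intro t ht
    rw [interior_Icc] at ht
    have ht' := Set.Ioo_subset_Icc_self ht
    obtain ⟨p, q, r⟩ := h t ht'
    have d2 := ((((log_sin_hasDerivAt p (by linarith)).comp t (l1 t)).mul_const u).add
      (((log_sin_hasDerivAt q (by linarith)).comp t (l2 t)).mul_const v)).add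
      ((HasDerivAt.comp t (log_sin_hasDerivAt (by linarith) (by linarith)) (l3 t)).mul_const
        (-u - v))
    have ev : deriv (fun t => lobachevsky (a + t * u)
      + lobachevsky (b + t * v) + lobachevsky (Real.pi - (a + t * u) - (b + t * v)))
      =ᶠ[nhds t] (fun t => -Real.log (2 * Real.sin (a + t * u)) * u
       + -Real.log (2 * Real.sin (b + t * v)) * v
       + -Real.log (2 * Real.sin (Real.pi - (a + t * u) - (b + t * v))) * (-u - v)) := by
      filter_upwards [isOpen_Ioo.mem_nhds ht] with s hs
      exact (d1 s (Set.Ioo_subset_Icc_self hs)).deriv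
    rw [Function.iterate_succ, Function.iterate_one, Function.comp_apply,
      ev.deriv_eq]
    refine lt_of_eq_of_lt (HasDerivAt.deriv d2) ?_
    have := cot_form_pos p q r huv
    nlinarith [this]

/-- The two-variable form `(α, β) ↦ Λ(α) + Λ(β) + Λ(π - α - β)` of the volume of
ideal hyperbolic tetrahedra is strictly concave on the open triangle
`{(α, β) : α > 0, β > 0, α + β < π}`. -/
theorem strictConcaveOn_lobachevsky_volume_two_var :
    StrictConcaveOn ℝ
      {p : ℝ × ℝ | 0 < p.1 ∧ 0 < p.2 ∧ p.1 + p.2 < Real.pi}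
      (fun p : ℝ × ℝ =>
        lobachevsky p.1 + lobachevsky p.2 + lobachevsky (Real.pi - p.1 - p.2)) := by
  have hconv : Convex ℝ {p : ℝ × ℝ | 0 < p.1 ∧ 0 < p.2 ∧ p.1 + p.2 < Real.pi} := by
    have c1 : Convex ℝ {p : ℝ × ℝ | 0 < p.1} :=
      convex_halfSpace_gt (LinearMap.fst ℝ ℝ ℝ).isLinear 0
    have c2 : Convex ℝ {p : ℝ × ℝ | 0 < p.2} :=
      convex_halfSpace_gt (LinearMap.snd ℝ ℝ ℝ).isLinear 0
    have c3 : Convex ℝ {p : ℝ × ℝ | p.1 + p.2 < Real.pi} :=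
      convex_halfSpace_lt (LinearMap.fst ℝ ℝ ℝ + LinearMap.snd ℝ ℝ ℝ).isLinear Real.pi
    exact c1.inter (c2.inter c3)
  refine ⟨hconv, ?_⟩
  rintro ⟨a, b⟩ hx ⟨c, d⟩ hy hne s t hs ht hst
  have huv : c - a ≠ 0 ∨ d - b ≠ 0 := by
    by_contra! hh
    apply hne
    ext
    · simp only; linarith [hh.1]
    · simp only; linarith [hh.2]
  have hline := line_strictConcave (a := a) (b := b) huv (by
    intro r hr
    have := hconv hx hy (sub_nonneg.2 hr.2) hr.1 (by ring)
    simp only [Set.mem_ofPred_eq, Prod.smul_mk, Prod.mk_add_mk, smul_eq_mul] at this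
    obtain ⟨p, q, w⟩ := this
    exact ⟨by linarith, by linarith, by linarith⟩)
  have := hline.2 (Set.left_mem_Icc.2 zero_le_one) (Set.right_mem_Icc.2 zero_le_one)
    zero_ne_one hs ht hst
  obtain rfl : s = 1 - t := by linarith
  simp only [smul_eq_mul, Prod.smul_mk, Prod.mk_add_mk, mul_zero, mul_one, zero_add, zero_mul,
    one_mul, add_zero, add_sub_cancel] at this ⊢
  rw [show (1 - t) * a + t * c = a + t * (c - a) by ring,
    show (1 - t) * b + t * d = b + t * (d - b) by ring]
  exact this
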